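/- arXiv:2505.01157 — 4 statements merged into one kernel-verified Lean document; each statement's English description precedes it below -/
import Mathlib

section
/- Let T > 0, C ≥ 1, C' > 0, and let f : [0, T] → ℝ be a nonnegative function satisfying f(t) ≤ C·f(s) + (t − s)^{2/5}·C'·f(t) for all 0 ≤ s ≤ t ≤ T. Then f(T) ≤ (2C)^{⌊T·(2C')^{5/2}⌋ + 1}·f(0); in particular there exist constants c, c' > 0 depending only on C and C' such that f(T) ≤ c·e^{c'·T}·f(0). -/
/-- A time step `h` with `h * (2a)^(5/2) ≤ 1` satisfies `h^(2/5) * a ≤ 1/2`. -/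
lemma rpow_two_fifths_mul_le_half {h a : ℝ} (hh : 0 ≤ h) (ha : 0 ≤ a)
    (hle : h * (2 * a) ^ ((5 : ℝ) / 2) ≤ 1) : h ^ ((2 : ℝ) / 5) * a ≤ 1 / 2 := by
  have h2a : 0 ≤ 2 * a := by positivity
  have hpow : (h * (2 * a) ^ ((5 : ℝ) / 2)) ^ ((2 : ℝ) / 5) ≤ 1 :=
    Real.rpow_le_one (by positivity) hle (by norm_num)
  rw [Real.mul_rpow hh (by positivity), ← Real.rpow_mul h2a,
    show (5 : ℝ) / 2 * (2 / 5) = 1 by norm_num, Real.rpow_one] at hpow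
  linarith

/-- If `f` grows by a factor at most `A ≥ 0` over every step `[s, t]` with `(t - s) * K ≤ 1`,
then it grows by a factor at most `A ^ n` over `[0, t]` whenever `t * K ≤ n`. -/
lemma le_pow_mul_of_step_le {f : ℝ → ℝ} {A K T : ℝ} (hA : 0 ≤ A) (hK : 0 < K)
    (hstep : ∀ s t, 0 ≤ s → s ≤ t → t ≤ T → (t - s) * K ≤ 1 → f t ≤ A * f s) (n : ℕ) :
    ∀ t, 0 ≤ t → t ≤ T → t * K ≤ n → f t ≤ A ^ n * f 0 := by
  induction n with
  | zero =>
    intro t ht _ htn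
    have : t = 0 := by
      push_cast at htn
      exact le_antisymm (nonpos_of_mul_nonpos_left htn hK) ht
    simp [this]
  | succ n ih =>
    intro t ht htT htn
    push_cast at htn
    have hKinv : K⁻¹ * K = 1 := inv_mul_cancel₀ hK.ne'
    have hs0 : 0 ≤ max 0 (t - K⁻¹) := le_max_left _ _
    have hst : max 0 (t - K⁻¹) ≤ t := max_le ht (by linarith [inv_pos.2 hK])
    have hsn : max 0 (t - K⁻¹) * K ≤ n := by
      rw [max_mul_of_nonneg _ _ hK.le, zero_mul, sub_mul, hKinv]
      exact max_le n.cast_nonneg (by linarith)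
    have hts : (t - max 0 (t - K⁻¹)) * K ≤ 1 := by
      rw [← hKinv]
      exact mul_le_mul_of_nonneg_right (by linarith [le_max_right 0 (t - K⁻¹)]) hK.le
    calc f t ≤ A * f (max 0 (t - K⁻¹)) := hstep _ t hs0 hst htT hts
      _ ≤ A * (A ^ n * f 0) := mul_le_mul_of_nonneg_left (ih _ hs0 (hst.trans htT) hsn) hA
      _ = A ^ (n + 1) * f 0 := by ring

/-- For `A ≥ 1`, the power `A ^ (⌊x⌋₊ + 1)` is at most `A * exp (log A * x)`. -/
lemma pow_floor_add_one_le_mul_exp {A x : ℝ} (hA : 1 ≤ A) (hx : 0 ≤ x) :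
    A ^ (⌊x⌋₊ + 1) ≤ A * Real.exp (Real.log A * x) := by
  have hA0 : 0 < A := by linarith
  rw [pow_succ', ← Real.rpow_def_of_pos hA0, ← Real.rpow_natCast]
  exact mul_le_mul_of_nonneg_left
    (Real.rpow_le_rpow_of_exponent_le hA (Nat.floor_le hx)) hA0.le

/-- The iteration argument in the proof of Theorem 5.3 of the paper: if a nonnegative
function `f` on `[0, T]` satisfies `f t ≤ C * f s + (t - s)^(2/5) * C' * f t` for all
`0 ≤ s ≤ t ≤ T`, with `C ≥ 1` and `C' > 0`, then
`f T ≤ (2C)^(⌊T * (2C')^(5/2)⌋ + 1) * f 0`; in particular `f T ≤ c * exp(c' * T) * f 0`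
for constants `c, c' > 0` depending only on `C` and `C'`. -/
theorem gronwall_iteration_exponential_bound
    (C C' : ℝ) (hC : 1 ≤ C) (hC' : 0 < C') :
    (∀ (T : ℝ) (f : ℝ → ℝ), 0 < T →
      (∀ t, 0 ≤ t → t ≤ T → 0 ≤ f t) →
      (∀ s t, 0 ≤ s → s ≤ t → t ≤ T →
        f t ≤ C * f s + (t - s) ^ ((2 : ℝ) / 5) * C' * f t) →
      f T ≤ (2 * C) ^ (⌊T * (2 * C') ^ ((5 : ℝ) / 2)⌋₊ + 1) * f 0) ∧
    ∃ c c' : ℝ, 0 < c ∧ 0 < c' ∧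
      ∀ (T : ℝ) (f : ℝ → ℝ), 0 < T →
        (∀ t, 0 ≤ t → t ≤ T → 0 ≤ f t) →
        (∀ s t, 0 ≤ s → s ≤ t → t ≤ T →
          f t ≤ C * f s + (t - s) ^ ((2 : ℝ) / 5) * C' * f t) →
        f T ≤ c * Real.exp (c' * T) * f 0 := by
  have hK : 0 < (2 * C') ^ ((5 : ℝ) / 2) := by positivity
  have hpow : ∀ (T : ℝ) (f : ℝ → ℝ), 0 < T →
      (∀ t, 0 ≤ t → t ≤ T → 0 ≤ f t) →
      (∀ s t, 0 ≤ s → s ≤ t → t ≤ T →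
        f t ≤ C * f s + (t - s) ^ ((2 : ℝ) / 5) * C' * f t) →
      f T ≤ (2 * C) ^ (⌊T * (2 * C') ^ ((5 : ℝ) / 2)⌋₊ + 1) * f 0 := by
    intro T f hT hf hle
    refine le_pow_mul_of_step_le (by linarith) hK ?_ _ T hT.le le_rfl ?_
    · intro s t hs hst htT hstep
      have habsorb := mul_le_mul_of_nonneg_right
        (rpow_two_fifths_mul_le_half (sub_nonneg.2 hst) hC'.le hstep) (hf t (hs.trans hst) htT)
      linarith [hle s t hs hst htT]
    · push_cast
      exact (Nat.lt_floor_add_one _).le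
  refine ⟨hpow, 2 * C, Real.log (2 * C) * (2 * C') ^ ((5 : ℝ) / 2), by linarith,
    mul_pos (Real.log_pos (by linarith)) hK, fun T f hT hf hle => ?_⟩
  refine (hpow T f hT hf hle).trans (mul_le_mul_of_nonneg_right ?_ (hf 0 le_rfl hT.le))
  rw [mul_assoc (Real.log _), mul_comm _ T]
  exact pow_floor_add_one_le_mul_exp (by linarith) (by positivity)
end

section
/- Let κ ∈ (0, 1), C ≥ 0, and let f : [0, ∞) → ℝ be a continuous nonnegative function satisfying f(t) − f(s) ≤ C·(t − s)^{1/10}·(1 + f(t)^{1−κ}) for all 0 ≤ s ≤ t with t − s ≤ 1. Then there exists a constant K > 0, depending only on C and κ, such that for every T ≥ 1 one has sup_{0 ≤ t ≤ T} f(t) ≤ 2·f(0) + K·(T + T^{1/κ}); in particular f grows at most polynomially in time. -/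
/-- Absorption of the sublinear term `M ^ (1 - κ)` into the left-hand side. -/
theorem le_of_le_add_mul_one_add_rpow {κ b A M : ℝ} (hκ : 0 < κ) (hb : 0 ≤ b) (hA : 0 ≤ A)
    (hM : 0 ≤ M) (h : M ≤ b + A * (1 + M ^ (1 - κ))) :
    M ≤ 2 * b + 2 * A + (2 * A) ^ (1 / κ) := by
  rcases le_or_gt (M ^ κ) (2 * A) with hle | hlt
  · have hroot : M ≤ (2 * A) ^ (1 / κ) := by
      calc M = (M ^ κ) ^ (1 / κ) := by
            rw [← Real.rpow_mul hM, mul_one_div_cancel hκ.ne', Real.rpow_one]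
        _ ≤ (2 * A) ^ (1 / κ) := by gcongr
    linarith
  · have hsplit : M ^ κ * M ^ (1 - κ) = M := by
      rw [← Real.rpow_add' hM (by norm_num), add_sub_cancel, Real.rpow_one]
    have hmul := mul_le_mul_of_nonneg_right hlt.le (Real.rpow_nonneg hM (1 - κ))
    have hpow : 0 ≤ (2 * A) ^ (1 / κ) := by positivity
    linarith

/-- A function whose increments over steps of length at most `1` are bounded by `B` grows by at
most `n * B` over `[0, n]`. -/
theorem le_add_nat_mul_of_increment_le {f : ℝ → ℝ} {B T : ℝ}
    (h : ∀ s t, 0 ≤ s → s ≤ t → t - s ≤ 1 → t ≤ T → f t - f s ≤ B) (hB : 0 ≤ B)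
    (n : ℕ) {t : ℝ} (ht : 0 ≤ t) (htn : t ≤ n) (htT : t ≤ T) : f t ≤ f 0 + n * B := by
  induction n generalizing t with
  | zero =>
    have ht0 : t = 0 := le_antisymm (by simpa using htn) ht
    simp [ht0]
  | succ n ih =>
    push_cast at htn ⊢
    rcases le_total t 1 with ht1 | ht1
    · have hstep := h 0 t le_rfl ht (by linarith) htT
      have hnB : 0 ≤ (n : ℝ) * B := by positivity
      linarith
    · have hstep := h (t - 1) t (by linarith) (by linarith) (by linarith) htT
      have hprev := ih (t := t - 1) (by linarith) (by linarith) (by linarith)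
      linarith

/-- The growth inference (5.20) ⇒ (5.21) in Proposition 5.11 of the paper: if a continuous
nonnegative function `f` on `[0, ∞)` satisfies
`f t - f s ≤ C * (t - s)^(1/10) * (1 + f t ^ (1 - κ))` for all `0 ≤ s ≤ t` with
`t - s ≤ 1`, then there is a constant `K > 0`, depending only on `C` and `κ`, such that
`sup_{0 ≤ t ≤ T} f t ≤ 2 * f 0 + K * (T + T^(1/κ))` for every `T ≥ 1`. -/
theorem polynomial_growth_of_sublinear_increment
    (κ C : ℝ) (hκ : κ ∈ Set.Ioo (0 : ℝ) 1) (hC : 0 ≤ C) :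
    ∃ K : ℝ, 0 < K ∧
      ∀ f : ℝ → ℝ, ContinuousOn f (Set.Ici 0) →
        (∀ t, 0 ≤ t → 0 ≤ f t) →
        (∀ s t, 0 ≤ s → s ≤ t → t - s ≤ 1 →
          f t - f s ≤ C * (t - s) ^ ((1 : ℝ) / 10) * (1 + f t ^ (1 - κ))) →
        ∀ T, 1 ≤ T → ∀ t, 0 ≤ t → t ≤ T →
          f t ≤ 2 * f 0 + K * (T + T ^ (1 / κ)) := by
  obtain ⟨hκ0, hκ1⟩ := hκ
  refine ⟨4 * C + (4 * C) ^ (1 / κ) + 1, by positivity, ?_⟩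
  intro f hf hpos hinc T hT t ht htT
  have hT0 : 0 ≤ T := zero_le_one.trans hT
  obtain ⟨τ, ⟨hτ0, hτT⟩, hmax⟩ := isCompact_Icc.exists_isMaxOn
    (Set.nonempty_Icc.mpr hT0) (hf.mono (Set.Icc_subset_Ici_self : Set.Icc 0 T ⊆ Set.Ici 0))
  have hM : 0 ≤ f τ := hpos τ hτ0
  have hB : 0 ≤ C * (1 + f τ ^ (1 - κ)) := by positivity
  have hstep : ∀ s t, 0 ≤ s → s ≤ t → t - s ≤ 1 → t ≤ T →
      f t - f s ≤ C * (1 + f τ ^ (1 - κ)) := by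
    intro s t hs hst hst1 htT
    have ht : 0 ≤ t := hs.trans hst
    have hft : 0 ≤ f t := hpos t ht
    have hle : f t ≤ f τ := hmax ⟨ht, htT⟩
    have hone : (t - s) ^ ((1 : ℝ) / 10) ≤ 1 :=
      Real.rpow_le_one (sub_nonneg.mpr hst) hst1 (by norm_num)
    have hpow : f t ^ (1 - κ) ≤ f τ ^ (1 - κ) :=
      Real.rpow_le_rpow hft hle (sub_nonneg.mpr hκ1.le)
    calc f t - f s ≤ C * (t - s) ^ ((1 : ℝ) / 10) * (1 + f t ^ (1 - κ)) := hinc s t hs hst hst1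
      _ ≤ C * 1 * (1 + f τ ^ (1 - κ)) := by gcongr
      _ = C * (1 + f τ ^ (1 - κ)) := by rw [mul_one]
  have hceil : (⌈T⌉₊ : ℝ) ≤ 2 * T := by linarith [Nat.ceil_lt_add_one hT0]
  have hgrow : f τ ≤ f 0 + 2 * T * C * (1 + f τ ^ (1 - κ)) := by
    calc f τ ≤ f 0 + ⌈T⌉₊ * (C * (1 + f τ ^ (1 - κ))) :=
          le_add_nat_mul_of_increment_le hstep hB _ hτ0 (hτT.trans (Nat.le_ceil T)) hτT
      _ ≤ f 0 + 2 * T * (C * (1 + f τ ^ (1 - κ))) := by gcongr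
      _ = f 0 + 2 * T * C * (1 + f τ ^ (1 - κ)) := by ring
  have habsorb := le_of_le_add_mul_one_add_rpow hκ0 (hpos 0 le_rfl) (by positivity) hM hgrow
  have hscale : (2 * (2 * T * C)) ^ (1 / κ) = (4 * C) ^ (1 / κ) * T ^ (1 / κ) := by
    rw [← Real.mul_rpow (by positivity) hT0]
    ring_nf
  rw [hscale] at habsorb
  have hle : f t ≤ f τ := hmax ⟨ht, htT⟩
  have hTpow : 0 ≤ T ^ (1 / κ) := by positivity
  have hCpow : 0 ≤ (4 * C) ^ (1 / κ) := by positivity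
  nlinarith [mul_nonneg hCpow hT0, mul_nonneg hC hTpow]
end

section
/- Let C > 0 and for each integer n ≥ 1 let a_n : [0, ∞) → ℝ be a continuous function such that 0 ≤ a_n(t) ≤ 2 for all t ≥ 0, and such that a_n(t) ≤ 2·n·C·∫₀ᵗ a_{n+1}(s) ds for every n ≥ 1 and every t ≥ 0. Then a_n(t) = 0 for every n ≥ 1 and every t with 0 ≤ t < 1/(8C). -/
/-- Iterating the hierarchy inequality `k` times, the simplex volume and the rising factorial
combine into a binomial coefficient. -/
theorem hierarchy_le_choose_mul_pow
    {C : ℝ} (hC : 0 < C) {a : ℕ → ℝ → ℝ}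
    (hcont : ∀ n, 1 ≤ n → ContinuousOn (a n) (Set.Ici 0))
    (hbdd : ∀ n, 1 ≤ n → ∀ t, 0 ≤ t → a n t ≤ 2)
    (hineq : ∀ n, 1 ≤ n → ∀ t, 0 ≤ t →
      a n t ≤ 2 * (n : ℝ) * C * ∫ s in (0 : ℝ)..t, a (n + 1) s)
    (k m : ℕ) {t : ℝ} (ht : 0 ≤ t) :
    a (m + 1) t ≤ 2 * ((m + k).choose k : ℝ) * (2 * C * t) ^ k := by
  induction k generalizing m t with
  | zero => simpa using hbdd (m + 1) (by omega) t ht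
  | succ k ih =>
    have hint : ∫ s in (0 : ℝ)..t, a (m + 1 + 1) s ≤
        ∫ s in (0 : ℝ)..t, 2 * ((m + 1 + k).choose k : ℝ) * (2 * C * s) ^ k := by
      refine intervalIntegral.integral_mono_on ht ?_ ?_ fun s hs => ih (m + 1) hs.1
      · refine ((hcont (m + 1 + 1) (by omega)).mono ?_).intervalIntegrable
        rw [Set.uIcc_of_le ht]
        exact Set.Icc_subset_Ici_self
      · exact Continuous.intervalIntegrable (by fun_prop) _ _
    have hchoose : ((m + (k + 1)).choose (k + 1) : ℝ) * (k + 1) =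
        ((m + 1 + k).choose k : ℝ) * (m + 1) := by
      have h := Nat.choose_succ_right_eq (m + 1 + k) k
      rw [Nat.add_sub_cancel, show m + 1 + k = m + (k + 1) by omega] at h
      rw [show m + 1 + k = m + (k + 1) by omega]
      exact_mod_cast h
    calc a (m + 1) t
        ≤ 2 * ((m + 1 : ℕ) : ℝ) * C * ∫ s in (0 : ℝ)..t, a (m + 1 + 1) s :=
          hineq (m + 1) (by omega) t ht
      _ ≤ 2 * ((m + 1 : ℕ) : ℝ) * C *
          ∫ s in (0 : ℝ)..t, 2 * ((m + 1 + k).choose k : ℝ) * (2 * C * s) ^ k := by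
          gcongr
      _ = 2 * (((m + 1 + k).choose k : ℝ) * (m + 1)) * (2 * C * t) ^ (k + 1) / (k + 1) := by
          simp only [mul_pow, intervalIntegral.integral_const_mul, integral_pow]
          push_cast
          rw [zero_pow (by omega)]
          ring
      _ = 2 * ((m + (k + 1)).choose (k + 1) : ℝ) * (2 * C * t) ^ (k + 1) := by
          rw [← hchoose]
          field_simp

/-- The Grönwall-type hierarchy iteration (6.49)–(6.50) proving uniqueness of mild solutions
of the BBGKY hierarchy (Theorem 6.4 of the paper): if `a n` are continuous functions on
`[0, ∞)` with `0 ≤ a n t ≤ 2`, satisfying `a n t ≤ 2 n C ∫₀ᵗ a (n+1) s ds` for all `n ≥ 1`,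
then `a n t = 0` for all `n ≥ 1` and `0 ≤ t < 1/(8C)`. -/
theorem bbgky_hierarchy_uniqueness_iteration
    (C : ℝ) (hC : 0 < C) (a : ℕ → ℝ → ℝ)
    (hcont : ∀ n, 1 ≤ n → ContinuousOn (a n) (Set.Ici 0))
    (hnonneg : ∀ n, 1 ≤ n → ∀ t, 0 ≤ t → 0 ≤ a n t)
    (hbdd : ∀ n, 1 ≤ n → ∀ t, 0 ≤ t → a n t ≤ 2)
    (hineq : ∀ n, 1 ≤ n → ∀ t, 0 ≤ t →
      a n t ≤ 2 * (n : ℝ) * C * ∫ s in (0 : ℝ)..t, a (n + 1) s) :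
    ∀ n, 1 ≤ n → ∀ t, 0 ≤ t → t < 1 / (8 * C) → a n t = 0 := by
  intro n hn t ht htC
  obtain ⟨m, rfl⟩ : ∃ m, n = m + 1 := ⟨n - 1, by omega⟩
  refine le_antisymm ?_ (hnonneg _ hn t ht)
  have hr0 : 0 ≤ 4 * C * t := by positivity
  have hr1 : 4 * C * t < 1 := by
    rw [lt_div_iff₀ (by positivity)] at htC
    linarith
  have hlim : Filter.Tendsto (fun k : ℕ => 2 * 2 ^ m * (4 * C * t) ^ k)
      Filter.atTop (nhds 0) := by
    simpa using (tendsto_pow_atTop_nhds_zero_of_lt_one hr0 hr1).const_mul (2 * 2 ^ m)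
  refine ge_of_tendsto' hlim fun k => ?_
  have hchoose : ((m + k).choose k : ℝ) ≤ 2 ^ (m + k) := by
    exact_mod_cast Nat.choose_le_two_pow (m + k) k
  calc a (m + 1) t
      ≤ 2 * ((m + k).choose k : ℝ) * (2 * C * t) ^ k :=
        hierarchy_le_choose_mul_pow hC hcont hbdd hineq k m ht
    _ ≤ 2 * 2 ^ (m + k) * (2 * C * t) ^ k := by gcongr
    _ = 2 * 2 ^ m * (4 * C * t) ^ k := by
        rw [show 4 * C * t = 2 * (2 * C * t) by ring, mul_pow 2 (2 * C * t), pow_add]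
        ring
end

section
/- Let γ ∈ (0, 1) and p ∈ (1, ∞) satisfy γ·p/(p − 1) < 1, let c ≥ 0, and let f, a : [0, 1] → ℝ be continuous nonnegative functions such that f(t) ≤ a(t) + c·∫₀ᵗ (t − s)^{−γ}·f(s) ds for every t ∈ [0, 1]. Then there exists a constant C₀ > 0, depending only on c, γ and p, such that f(t)^p ≤ C₀·( a(t)^p + ∫₀ᵗ a(s)^p ds ) for all t ∈ [0, 1]. -/
open MeasureTheory Set

/-- The integral form of Grönwall's inequality with a constant kernel. -/
theorem le_add_mul_integral_of_le_add_mul_integral {g b : ℝ → ℝ} {K T : ℝ} (hK : 0 ≤ K)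
    (hg : ContinuousOn g (Icc 0 T)) (hb : ContinuousOn b (Icc 0 T))
    (hb0 : ∀ t ∈ Icc 0 T, 0 ≤ b t)
    (h : ∀ t ∈ Icc 0 T, g t ≤ b t + K * ∫ s in (0 : ℝ)..t, g s) {t : ℝ} (ht : t ∈ Icc 0 T) :
    g t ≤ b t + K * (Real.exp (K * t) * ∫ s in (0 : ℝ)..t, b s) := by
  have hT : 0 ≤ T := ht.1.trans ht.2
  have hasDeriv : ∀ {u : ℝ → ℝ}, ContinuousOn u (Icc 0 T) → ∀ x ∈ Ioo 0 T,
      HasDerivAt (fun y => ∫ s in (0 : ℝ)..y, u s) (u x) x := fun {u} hu x hx =>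
    intervalIntegral.integral_hasDerivAt_right
      ((hu.mono (Icc_subset_Icc_right hx.2.le)).intervalIntegrable_of_Icc hx.1.le)
      ((hu.mono Ioo_subset_Icc_self).stronglyMeasurableAtFilter isOpen_Ioo x hx)
      (hu.continuousAt (Icc_mem_nhds hx.1 hx.2))
  have hcont : ∀ {u : ℝ → ℝ}, ContinuousOn u (Icc 0 T) →
      ContinuousOn (fun y => ∫ s in (0 : ℝ)..y, u s) (Icc 0 T) := fun {u} hu => by
    have := intervalIntegral.continuousOn_primitive_interval (a := 0) (b := T) (f := u)
      (μ := volume) (by rw [uIcc_of_le hT]; exact hu.integrableOn_Icc)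
    rwa [uIcc_of_le hT] at this
  have hderiv : ∀ x ∈ Ioo 0 T, HasDerivAt
      (fun y => Real.exp (-(K * y)) * (∫ s in (0 : ℝ)..y, g s) - ∫ s in (0 : ℝ)..y, b s)
      (Real.exp (-(K * x)) * (g x - K * ∫ s in (0 : ℝ)..x, g s) - b x) x := fun x hx => by
    have hexp : HasDerivAt (fun y => Real.exp (-(K * y))) (Real.exp (-(K * x)) * -K) x := by
      simpa using (((hasDerivAt_id x).const_mul K).neg).exp
    exact ((hexp.mul (hasDeriv hg x hx)).sub (hasDeriv hb x hx)).congr_deriv (by ring)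
  have hanti : AntitoneOn
      (fun y => Real.exp (-(K * y)) * (∫ s in (0 : ℝ)..y, g s) - ∫ s in (0 : ℝ)..y, b s)
      (Icc 0 T) := by
    refine antitoneOn_of_deriv_nonpos (convex_Icc 0 T)
      (((by fun_prop : Continuous fun y => Real.exp (-(K * y))).continuousOn.mul
        (hcont hg)).sub (hcont hb)) ?_ ?_ <;> rw [interior_Icc]
    · exact fun x hx => (hderiv x hx).differentiableAt.differentiableWithinAt
    · intro x hx
      have hxI := Ioo_subset_Icc_self hx
      rw [(hderiv x hx).deriv, sub_nonpos]
      calc Real.exp (-(K * x)) * (g x - K * ∫ s in (0 : ℝ)..x, g s)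
          ≤ Real.exp (-(K * x)) * b x := by
            gcongr
            linarith [h x hxI]
        _ ≤ b x := mul_le_of_le_one_left (hb0 x hxI)
            (Real.exp_le_one_iff.2 (neg_nonpos.2 (mul_nonneg hK hx.1.le)))
  have hle : Real.exp (-(K * t)) * (∫ s in (0 : ℝ)..t, g s) ≤ ∫ s in (0 : ℝ)..t, b s := by
    simpa using hanti (left_mem_Icc.2 hT) ht ht.1
  refine (h t ht).trans ?_
  gcongr
  rwa [Real.exp_neg, inv_mul_le_iff₀ (Real.exp_pos _)] at hle

/-- Hölder's inequality against the kernel `(t - s) ^ (-γ)` on `[0, t]`, for `t ≤ 1`. -/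
theorem integral_sub_rpow_mul_le {γ p q t : ℝ} (hpq : p.HolderConjugate q) (hγq : γ * q < 1)
    (ht : t ∈ Icc (0 : ℝ) 1) {f : ℝ → ℝ} (hf : ContinuousOn f (Icc 0 t))
    (hf0 : ∀ s ∈ Icc 0 t, 0 ≤ f s) :
    ∫ s in (0 : ℝ)..t, (t - s) ^ (-γ) * f s ≤
      (1 / (1 - γ * q)) ^ (1 / q) * (∫ s in (0 : ℝ)..t, f s ^ p) ^ (1 / p) := by
  have hpow : ∀ s ∈ Ioc 0 t, ((t - s) ^ (-γ)) ^ q = (t - s) ^ (-(γ * q)) := fun s hs => by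
    rw [← Real.rpow_mul (sub_nonneg.2 hs.2), neg_mul]
  have hk0 : ∀ᵐ s ∂volume.restrict (Ioc 0 t), 0 ≤ (t - s) ^ (-γ) :=
    (ae_restrict_iff' measurableSet_Ioc).2 <| .of_forall fun s hs =>
      Real.rpow_nonneg (sub_nonneg.2 hs.2) _
  have hf0' : ∀ᵐ s ∂volume.restrict (Ioc 0 t), 0 ≤ f s :=
    (ae_restrict_iff' measurableSet_Ioc).2 <| .of_forall fun s hs =>
      hf0 s (Ioc_subset_Icc_self hs)
  have hkint : IntegrableOn (fun s => (t - s) ^ (-(γ * q))) (Ioc 0 t) := by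
    rw [← intervalIntegrable_iff_integrableOn_Ioc_of_le ht.1]
    simpa using ((intervalIntegral.intervalIntegrable_rpow' (a := 0) (b := t)
      (by linarith : -1 < -(γ * q))).comp_sub_left t).symm
  have hkLp : MemLp (fun s => (t - s) ^ (-γ)) (ENNReal.ofReal q) (volume.restrict (Ioc 0 t)) := by
    rw [← integrable_norm_rpow_iff (by fun_prop : Measurable _).aestronglyMeasurable
      (by simpa using hpq.symm.pos) ENNReal.ofReal_ne_top, ENNReal.toReal_ofReal hpq.symm.nonneg]
    refine hkint.congr_fun (fun s hs => ?_) measurableSet_Ioc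
    rw [Real.norm_of_nonneg (Real.rpow_nonneg (sub_nonneg.2 hs.2) _), hpow s hs]
  have hfLp : MemLp f (ENNReal.ofReal p) (volume.restrict (Ioc 0 t)) := by
    refine MemLp.mono_measure (Measure.restrict_mono Ioc_subset_Icc_self le_rfl) ?_
    rw [← integrable_norm_rpow_iff (hf.aestronglyMeasurable measurableSet_Icc)
      (by simpa using hpq.pos) ENNReal.ofReal_ne_top, ENNReal.toReal_ofReal hpq.nonneg]
    exact (hf.norm.rpow_const fun _ _ => Or.inr hpq.nonneg).integrableOn_Icc
  have hkval : ∫ s in Ioc 0 t, ((t - s) ^ (-γ)) ^ q ≤ 1 / (1 - γ * q) := by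
    rw [setIntegral_congr_fun measurableSet_Ioc hpow, ← intervalIntegral.integral_of_le ht.1,
      intervalIntegral.integral_comp_sub_left (fun s => s ^ (-(γ * q))) t, sub_self, sub_zero,
      integral_rpow (Or.inl (by linarith)), Real.zero_rpow (by linarith), sub_zero,
      neg_add_eq_sub]
    have : 0 < 1 - γ * q := by linarith
    gcongr
    exact Real.rpow_le_one ht.1 ht.2 this.le
  have hkval0 : 0 ≤ ∫ s in Ioc 0 t, ((t - s) ^ (-γ)) ^ q :=
    integral_nonneg_of_ae (hk0.mono fun s hs => Real.rpow_nonneg hs _)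
  rw [intervalIntegral.integral_of_le ht.1, intervalIntegral.integral_of_le ht.1]
  refine (integral_mul_le_Lp_mul_Lq_of_nonneg hpq.symm hk0 hf0' hkLp hfLp).trans ?_
  have hq := hpq.symm.pos
  gcongr
  exact Real.rpow_nonneg (integral_nonneg_of_ae (hf0'.mono fun s hs => Real.rpow_nonneg hs _)) _

/-- The singular-kernel Grönwall argument used in the heat kernel estimates for the
transformed Anderson Hamiltonian (Lemma 2.12 of the paper): if
`f t ≤ a t + c ∫₀ᵗ (t - s)^(-γ) f s ds` on `[0, 1]` with `γ ∈ (0,1)`, `p ∈ (1, ∞)` and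
`γ p / (p - 1) < 1`, then `f t ^ p ≤ C₀ (a t ^ p + ∫₀ᵗ a s ^ p ds)` for a constant `C₀`
depending only on `c`, `γ` and `p`. -/
theorem singular_gronwall
    (γ p c : ℝ) (hγ : γ ∈ Set.Ioo (0 : ℝ) 1) (hp : 1 < p)
    (hγp : γ * p / (p - 1) < 1) (hc : 0 ≤ c) :
    ∃ C₀ : ℝ, 0 < C₀ ∧
      ∀ f a : ℝ → ℝ,
        ContinuousOn f (Set.Icc 0 1) → ContinuousOn a (Set.Icc 0 1) →
        (∀ t ∈ Set.Icc (0 : ℝ) 1, 0 ≤ f t) →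
        (∀ t ∈ Set.Icc (0 : ℝ) 1, 0 ≤ a t) →
        (∀ t ∈ Set.Icc (0 : ℝ) 1,
          f t ≤ a t + c * ∫ s in (0 : ℝ)..t, (t - s) ^ (-γ) * f s) →
        ∀ t ∈ Set.Icc (0 : ℝ) 1,
          f t ^ p ≤ C₀ * (a t ^ p + ∫ s in (0 : ℝ)..t, a s ^ p) := by
  set q := p / (p - 1) with hq
  have hpq : p.HolderConjugate q := Real.HolderConjugate.conjExponent hp
  have hγq : γ * q < 1 := by rwa [hq, ← mul_div_assoc]
  have hp0 : 0 < p := hpq.pos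
  have hM0 : 0 ≤ 1 / (1 - γ * q) := one_div_nonneg.2 (by linarith)
  set D := c * (1 / (1 - γ * q)) ^ (1 / q) with hD
  have hD0 : 0 ≤ D := mul_nonneg hc (Real.rpow_nonneg hM0 _)
  set A : ℝ := 2 ^ (p - 1)
  have hA0 : 0 < A := Real.rpow_pos_of_pos two_pos _
  set K := A * D ^ p
  have hK0 : 0 ≤ K := mul_nonneg hA0.le (Real.rpow_nonneg hD0 _)
  refine ⟨A * (1 + K * Real.exp K), by positivity, fun f a hf ha hf0 ha0 h t ht => ?_⟩
  have hrpow : ∀ t ∈ Icc (0 : ℝ) 1,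
      f t ^ p ≤ A * a t ^ p + K * ∫ s in (0 : ℝ)..t, f s ^ p := fun t ht => by
    have hsub : Icc 0 t ⊆ Icc 0 1 := Icc_subset_Icc_right ht.2
    have hI0 : 0 ≤ ∫ s in (0 : ℝ)..t, f s ^ p :=
      intervalIntegral.integral_nonneg ht.1 fun s hs => Real.rpow_nonneg (hf0 s (hsub hs)) _
    have hle : f t ≤ a t + D * (∫ s in (0 : ℝ)..t, f s ^ p) ^ (1 / p) := by
      refine (h t ht).trans ?_
      rw [hD, mul_assoc]
      gcongr
      exact integral_sub_rpow_mul_le hpq hγq ht (hf.mono hsub) fun s hs => hf0 s (hsub hs)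
    calc f t ^ p ≤ (a t + D * (∫ s in (0 : ℝ)..t, f s ^ p) ^ (1 / p)) ^ p :=
          Real.rpow_le_rpow (hf0 t ht) hle hp0.le
      _ ≤ A * (a t ^ p + (D * (∫ s in (0 : ℝ)..t, f s ^ p) ^ (1 / p)) ^ p) :=
          mod_cast NNReal.rpow_add_le_mul_rpow_add_rpow ⟨a t, ha0 t ht⟩
            ⟨D * (∫ s in (0 : ℝ)..t, f s ^ p) ^ (1 / p), by positivity⟩ hp.le
      _ = A * a t ^ p + K * ∫ s in (0 : ℝ)..t, f s ^ p := by
          rw [Real.mul_rpow hD0 (by positivity), ← Real.rpow_mul hI0, one_div_mul_cancel hp0.ne',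
            Real.rpow_one]
          ring
  have hgronwall := le_add_mul_integral_of_le_add_mul_integral hK0
    (hf.rpow_const fun _ _ => Or.inr hp0.le)
    ((ha.rpow_const fun _ _ => Or.inr hp0.le).const_mul A)
    (fun t ht => mul_nonneg hA0.le (Real.rpow_nonneg (ha0 t ht) _)) hrpow ht
  have hI0 : 0 ≤ ∫ s in (0 : ℝ)..t, a s ^ p :=
    intervalIntegral.integral_nonneg ht.1 fun s hs =>
      Real.rpow_nonneg (ha0 s ⟨hs.1, hs.2.trans ht.2⟩) _
  have hat : 0 ≤ a t ^ p := Real.rpow_nonneg (ha0 t ht) _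
  rw [intervalIntegral.integral_const_mul] at hgronwall
  calc f t ^ p ≤ A * a t ^ p + K * (Real.exp (K * t) * (A * ∫ s in (0 : ℝ)..t, a s ^ p)) :=
        hgronwall
    _ ≤ A * a t ^ p + K * (Real.exp K * (A * ∫ s in (0 : ℝ)..t, a s ^ p)) := by
        gcongr
        exact mul_le_of_le_one_right hK0 ht.2
    _ ≤ A * (1 + K * Real.exp K) * (a t ^ p + ∫ s in (0 : ℝ)..t, a s ^ p) := by
        have h₁ : 0 ≤ A * (K * Real.exp K) * a t ^ p := by positivity
        have h₂ : 0 ≤ A * ∫ s in (0 : ℝ)..t, a s ^ p := by positivity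
        linarith
end
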